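/- For a vertex-weighted graph (G,w) with total weight w(G) and |V(G)| vertices, (−1)^{w(G)−|V(G)|} ω(X_{(G,w)}) = Σ_{(γ,κ)} Π_{v∈V(G)} x_{κ(v)}^{w(v)}, where the sum runs over pairs of an acyclic orientation γ of G and a colouring κ: V(G) → ℤ⁺ such that every directed edge u → v of γ satisfies κ(u) ≤ κ(v). -/

import Mathlib

open scoped Classical
open Finset

structure WGraph where
  V : Type
  E : Type
  [fV : Fintype V]
  [fE : Fintype E]
  ends : E → Sym2 V
  w : V → ℕ
  wpos : ∀ v, 0 < w v

attribute [instance] WGraph.fV WGraph.fE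

namespace WGraph

variable (G : WGraph)

/-- The monomial (exponent vector) attached to a colouring. -/
noncomputable def mono (κ : G.V → ℕ) : ℕ →₀ ℕ := ∑ v : G.V, Finsupp.single (κ v) (G.w v)

/-- A colouring is proper if the endpoints of every edge receive distinct colours. -/
def Proper {C : Type} (κ : G.V → C) : Prop := ∀ e : G.E, ¬ ((G.ends e).map κ).IsDiag

noncomputable def colorings (d : ℕ →₀ ℕ) : Finset (G.V → ℕ) :=
  (Fintype.piFinset fun _ : G.V => d.support).filter (fun κ => G.mono κ = d)

/-- The chromatic symmetric function of a vertex-weighted graph. -/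
noncomputable def X (R : Type) [CommRing R] : MvPowerSeries ℕ R :=
  fun d => (((G.colorings d).filter (fun κ => G.Proper κ)).card : R)

end WGraph
/-- The power sum symmetric function `p_n = Σ_k x_k^n`. -/
noncomputable def psum (n : ℕ) : MvPowerSeries ℕ ℚ :=
  fun d => if ∃ k, d = Finsupp.single k n then 1 else 0

/-- `p_λ = p_{λ₁} ⋯ p_{λ_k}` for a partition `λ` given as a multiset of parts. -/
noncomputable def pProd (M : Multiset ℕ) : MvPowerSeries ℕ ℚ :=
  (M.map psum).prod

namespace WGraph

variable (G : WGraph)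

/-- An orientation assigns to each edge an ordered pair of its endpoints. -/
def IsOrientation (o : G.E → G.V × G.V) : Prop :=
  ∀ e, s((o e).1, (o e).2) = G.ends e

/-- The directed-edge relation of an orientation. -/
def dirRel (o : G.E → G.V × G.V) (a b : G.V) : Prop := ∃ e, o e = (a, b)

/-- The orientation is acyclic: no directed cycle. -/
def IsAcyclic (o : G.E → G.V × G.V) : Prop :=
  G.IsOrientation o ∧ ∀ v, ¬ Relation.TransGen (G.dirRel o) v v

/-- The colouring `κ` is weakly increasing along every directed edge of `o`. -/
def Compatible (o : G.E → G.V × G.V) (κ : G.V → ℕ) : Prop :=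
  ∀ e, κ (o e).1 ≤ κ (o e).2

/-- The total weight `w(G)` of the graph. -/
noncomputable def wG : ℕ := ∑ v : G.V, G.w v

/-- The generating function `Σ_{(γ,κ)} Π_v x_{κ(v)}^{w(v)}` over pairs of an acyclic
orientation `γ` and a colouring `κ : V(G) → ℤ⁺` weakly increasing along `γ`. -/
noncomputable def ascSeries : MvPowerSeries ℕ ℚ :=
  fun d => ∑ κ ∈ G.colorings d,
    ((Finset.univ.filter
        (fun γ : {o : G.E → G.V × G.V // G.IsAcyclic o} => G.Compatible γ.1 κ)).card : ℚ)

end WGraph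

/-- If `R'` adds to `R` at most the arc `a → b`, then a walk of `R'` is a walk of `R` or passes
through that arc. -/
theorem transGen_or_arc {α : Type*} {R R' : α → α → Prop} {a b : α}
    (hR : ∀ x y, R' x y → R x y ∨ (x = a ∧ y = b)) {u v : α}
    (h : Relation.TransGen R' u v) :
    Relation.TransGen R u v ∨ (Relation.ReflTransGen R u a ∧ Relation.ReflTransGen R b v) := by
  induction h with
  | single h =>
    rcases hR _ _ h with h | ⟨rfl, rfl⟩
    · exact .inl (.single h)
    · exact .inr ⟨.refl, .refl⟩
  | tail _ h ih =>
    rcases hR _ _ h with h | ⟨rfl, rfl⟩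
    · rcases ih with ih | ⟨h1, h2⟩
      · exact .inl (ih.tail h)
      · exact .inr ⟨h1, h2.tail h⟩
    · rcases ih with ih | ⟨h1, h2⟩
      · exact .inr ⟨ih.to_reflTransGen, .refl⟩
      · exact .inr ⟨h1, .refl⟩

/-- Walks in the image of `R` under a map that only identifies points of `S` lift to walks of `R`
that may jump once between points of `S`, if no walk of `R` joins points of `S`. -/
theorem transGen_map_lift {α β : Type*} {R : α → α → Prop} {R' : β → β → Prop} {π : α → β}
    {S : Set α} (hπ : ∀ u v, π u = π v → u = v ∨ (u ∈ S ∧ v ∈ S))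
    (hS : ∀ u ∈ S, ∀ v ∈ S, ¬ Relation.TransGen R u v)
    (hR : ∀ x y, R' x y → ∃ u v, π u = x ∧ π v = y ∧ R u v) {x y : β}
    (h : Relation.TransGen R' x y) :
    ∃ u v, π u = x ∧ π v = y ∧ (Relation.TransGen R u v ∨ ∃ c ∈ S, ∃ d ∈ S,
      (Relation.TransGen R u c ∧ Relation.TransGen R d v)) := by
  induction h with
  | single h =>
    obtain ⟨u, v, hu, hv, h⟩ := hR _ _ h
    exact ⟨u, v, hu, hv, .inl (.single h)⟩
  | tail _ h ih =>
    obtain ⟨u, v, hu, hv, ih⟩ := ih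
    obtain ⟨v', w, hv', hw, h⟩ := hR _ _ h
    refine ⟨u, w, hu, hw, ?_⟩
    rcases hπ v v' (hv.trans hv'.symm) with rfl | ⟨hvS, hvS'⟩
    · rcases ih with ih | ⟨c, hc, d, hd, h1, h2⟩
      · exact .inl (ih.tail h)
      · exact .inr ⟨c, hc, d, hd, h1, h2.tail h⟩
    · rcases ih with ih | ⟨c, hc, d, hd, h1, h2⟩
      · exact .inr ⟨v, hvS, v', hvS', ih, .single h⟩
      · exact absurd h2 (hS _ hd _ hvS)

theorem map_irrefl_transGen {α β : Type*} {R : α → α → Prop} {R' : β → β → Prop} {π : α → β}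
    {S : Set α} (hπ : ∀ u v, π u = π v → u = v ∨ (u ∈ S ∧ v ∈ S))
    (hS : ∀ u ∈ S, ∀ v ∈ S, ¬ Relation.TransGen R u v)
    (hR : ∀ x y, R' x y → ∃ u v, π u = x ∧ π v = y ∧ R u v)
    (hac : ∀ v, ¬ Relation.TransGen R v v) (x : β) : ¬ Relation.TransGen R' x x := by
  intro h
  obtain ⟨u, v, hu, hv, h⟩ := transGen_map_lift hπ hS hR h
  rcases hπ u v (hu.trans hv.symm) with rfl | ⟨huS, hvS⟩
  · rcases h with h | ⟨c, hc, d, hd, h1, h2⟩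
    · exact hac _ h
    · exact hS _ hd _ hc (h2.trans h1)
  · rcases h with h | ⟨c, hc, d, hd, h1, h2⟩
    · exact hS _ huS _ hvS h
    · exact hS _ huS _ hc h1

namespace WGraph

variable (G : WGraph)

theorem mem_colorings {d : ℕ →₀ ℕ} {κ : G.V → ℕ} : κ ∈ G.colorings d ↔ G.mono κ = d := by
  unfold colorings
  rw [mem_filter, and_iff_right_iff_imp]
  rintro rfl
  rw [Fintype.mem_piFinset]
  intro v
  have h : G.w v ≤ G.mono κ (κ v) := by
    unfold mono
    rw [Finsupp.finsetSum_apply]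
    refine le_trans ?_ (single_le_sum (f := fun i => (Finsupp.single (κ i) (G.w i)) (κ v))
      (fun _ _ => Nat.zero_le _) (mem_univ v))
    simp
  have := G.wpos v
  rw [Finsupp.mem_support_iff]
  omega

theorem card_le_wG : Fintype.card G.V ≤ G.wG := by
  unfold wG
  simpa using Finset.card_nsmul_le_sum (univ : Finset G.V) G.w 1 (fun v _ => G.wpos v)

/-- The weighted generating function `Σ_κ F(κ) Π_v x_{κ(v)}^{w(v)}`. -/
noncomputable def genSeries (F : (G.V → ℕ) → ℚ) : MvPowerSeries ℕ ℚ :=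
  fun d => ∑ κ ∈ G.colorings d, F κ

/-- The acyclic orientations along which `κ` is weakly increasing. -/
noncomputable def compatOrientations (κ : G.V → ℕ) : Finset (G.E → G.V × G.V) :=
  univ.filter fun o => G.IsAcyclic o ∧ G.Compatible o κ

theorem mem_compatOrientations {κ : G.V → ℕ} {o : G.E → G.V × G.V} :
    o ∈ G.compatOrientations κ ↔ G.IsAcyclic o ∧ G.Compatible o κ := by
  simp [compatOrientations]

theorem X_eq_genSeries : G.X ℚ = G.genSeries fun κ => if G.Proper κ then 1 else 0 := by
  funext d
  simp [X, genSeries]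

theorem ascSeries_eq_genSeries :
    G.ascSeries = G.genSeries fun κ => ((G.compatOrientations κ).card : ℚ) := by
  funext d
  unfold ascSeries genSeries
  refine sum_congr rfl fun κ _ => ?_
  congr 1
  refine card_bij (fun γ _ => γ.1) ?_ ?_ ?_
  · intro γ hγ
    exact G.mem_compatOrientations.2 ⟨γ.2, by simpa using hγ⟩
  · intro γ _ γ' _ h
    exact Subtype.ext h
  · intro o ho
    rw [mem_compatOrientations] at ho
    exact ⟨⟨o, ho.1⟩, by simpa using ho.2, rfl⟩

/-- Deletion of an edge. -/
noncomputable abbrev delete (e : G.E) : WGraph where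
  V := G.V
  E := {x : G.E // x ≠ e}
  ends x := G.ends x
  w := G.w
  wpos := G.wpos

variable {G} in
/-- The map identifying `b` with `a`. -/
noncomputable def proj {a b : G.V} (h : a ≠ b) (v : G.V) : {v : G.V // v ≠ b} :=
  if hv : v = b then ⟨a, h⟩ else ⟨v, hv⟩

section proj

variable {G} {a b : G.V} (h : a ≠ b)

theorem proj_right : proj h b = ⟨a, h⟩ := by simp [proj]

theorem proj_coe (v : {v : G.V // v ≠ b}) : proj h v = v := by simp [proj, v.2]

theorem proj_left : proj h a = ⟨a, h⟩ := proj_coe h ⟨a, h⟩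

theorem eq_or_mem_of_proj_eq (u v : G.V) (huv : proj h u = proj h v) :
    u = v ∨ (u ∈ ({a, b} : Set G.V) ∧ v ∈ ({a, b} : Set G.V)) := by
  unfold proj at huv
  split_ifs at huv <;> simp_all

theorem apply_proj {κ : G.V → ℕ} (hκ : κ a = κ b) (v : G.V) : κ (proj h v) = κ v := by
  unfold proj
  split_ifs with hv
  · simp [hv, hκ]
  · rfl

end proj

variable {G} in
/-- Contraction of an edge `e` with endpoints `a` and `b`. -/
noncomputable abbrev contract (e : G.E) {a b : G.V} (h : a ≠ b) : WGraph where
  V := {v : G.V // v ≠ b}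
  E := {x : G.E // x ≠ e}
  ends x := (G.ends x).map (proj h)
  w v := ∑ u with proj h u = v, G.w u
  wpos v := lt_of_lt_of_le (G.wpos v)
    (single_le_sum (f := G.w) (fun _ _ => Nat.zero_le _) (by simp [proj_coe]))

theorem wG_contract (e : G.E) {a b : G.V} (h : a ≠ b) : (contract e h).wG = G.wG := by
  unfold wG
  exact sum_fiberwise (univ : Finset G.V) (proj h) G.w

theorem card_contract (e : G.E) {a b : G.V} (h : a ≠ b) :
    Fintype.card (contract e h).V + 1 = Fintype.card G.V := by
  have h1 : Fintype.card (contract e h).V = Fintype.card {v : G.V // v ≠ b} :=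
    Fintype.card_congr (Equiv.refl _)
  have h2 : Fintype.card {v : G.V // v ≠ b} = Fintype.card G.V - 1 := by
    simp [Fintype.card_subtype_compl]
  have h3 : 0 < Fintype.card G.V := Fintype.card_pos_iff.2 ⟨a⟩
  omega

theorem mono_contract (e : G.E) {a b : G.V} (h : a ≠ b) (κ : {v : G.V // v ≠ b} → ℕ) :
    (contract e h).mono κ = G.mono (fun v => κ (proj h v)) := by
  unfold mono
  rw [← sum_fiberwise (univ : Finset G.V) (proj h)]
  refine sum_congr rfl fun v _ => ?_
  change Finsupp.single (κ v) (∑ u with proj h u = v, G.w u) = _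
  rw [Finsupp.single_finsetSum]
  refine sum_congr rfl fun u hu => ?_
  rw [← (mem_filter.1 hu).2]

theorem genSeries_contract (e : G.E) {a b : G.V} (h : a ≠ b)
    (F : ({v : G.V // v ≠ b} → ℕ) → ℚ) :
    (contract e h).genSeries F =
      G.genSeries fun κ => if κ a = κ b then F (fun v => κ v) else 0 := by
  funext d
  unfold genSeries
  rw [← sum_filter]
  refine sum_bij' (fun κ _ => fun v => κ (proj h v)) (fun κ _ => fun v => κ v) ?_ ?_ ?_ ?_ ?_
  · intro κ hκ
    rw [mem_colorings, mono_contract] at hκ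
    simp [mem_colorings, hκ, proj_left, proj_right]
  · intro κ hκ
    rw [mem_filter, mem_colorings] at hκ
    rw [mem_colorings, mono_contract]
    simp only [apply_proj h hκ.2]
    exact hκ.1
  · intro κ _
    funext v
    exact congrArg κ (proj_coe h v)
  · intro κ hκ
    funext v
    exact apply_proj h (mem_filter.1 hκ).2 v
  · intro κ _
    congr 1
    funext v
    exact (congrArg κ (proj_coe h v)).symm

theorem proper_iff_delete {e : G.E} {a b : G.V} (he : G.ends e = s(a, b)) (κ : G.V → ℕ) :
    G.Proper κ ↔ (G.delete e).Proper κ ∧ κ a ≠ κ b := by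
  constructor
  · intro hp
    refine ⟨fun x => hp x.1, ?_⟩
    have := hp e
    rw [he] at this
    simpa using this
  · rintro ⟨h1, h2⟩ x
    by_cases hx : x = e
    · subst hx
      rw [he]
      simpa using h2
    · exact h1 ⟨x, hx⟩

theorem proper_contract_iff (e : G.E) {a b : G.V} (h : a ≠ b) {κ : G.V → ℕ} (hκ : κ a = κ b) :
    (contract e h).Proper (fun v : {v : G.V // v ≠ b} => κ v) ↔ (G.delete e).Proper κ := by
  refine forall_congr' fun x => ?_
  change ¬ (((G.ends x.1).map (proj h)).map (fun v : {v : G.V // v ≠ b} => κ v)).IsDiag ↔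
    ¬ ((G.ends x.1).map κ).IsDiag
  rw [Sym2.map_map]
  have : (fun v : {v : G.V // v ≠ b} => κ v) ∘ proj h = κ := funext (apply_proj h hκ)
  rw [this]

theorem genSeries_add (F F' : (G.V → ℕ) → ℚ) :
    G.genSeries (fun κ => F κ + F' κ) = G.genSeries F + G.genSeries F' := by
  funext d
  exact sum_add_distrib

theorem X_deletion_contraction {e : G.E} {a b : G.V} (h : a ≠ b) (he : G.ends e = s(a, b)) :
    G.X ℚ = (G.delete e).X ℚ - (contract e h).X ℚ := by
  rw [eq_sub_iff_add_eq, X_eq_genSeries, X_eq_genSeries, X_eq_genSeries]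
  rw [genSeries_contract]
  rw [← genSeries_add]
  change _ = G.genSeries _
  congr 1
  funext κ
  have h1 := G.proper_iff_delete he κ
  by_cases hκ : κ a = κ b
  · have h2 := G.proper_contract_iff e h hκ
    simp [h1, hκ, h2]
  · simp [h1, hκ]

theorem acyclic_iff_delete {e : G.E} {a b : G.V} (h : a ≠ b) (he : G.ends e = s(a, b))
    {o : G.E → G.V × G.V} (ho : o e = (a, b)) :
    G.IsAcyclic o ↔ (G.delete e).IsAcyclic (fun x => o x.1) ∧
      ¬ Relation.TransGen ((G.delete e).dirRel (fun x => o x.1)) b a := by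
  have hle : ∀ x y, (G.delete e).dirRel (fun x => o x.1) x y → G.dirRel o x y :=
    fun x y ⟨f, hf⟩ => ⟨f.1, hf⟩
  constructor
  · rintro ⟨h1, h2⟩
    refine ⟨⟨fun x => h1 x.1, fun v hv => h2 v (Relation.TransGen.mono hle _ _ hv)⟩, fun hba => ?_⟩
    exact h2 b ((Relation.TransGen.mono hle _ _ hba).tail ⟨e, ho⟩)
  · rintro ⟨⟨h1, h2⟩, h3⟩
    refine ⟨fun x => ?_, fun v hv => ?_⟩
    · by_cases hx : x = e
      · subst hx
        rw [ho, he]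
      · exact h1 ⟨x, hx⟩
    · have := transGen_or_arc (R := (G.delete e).dirRel (fun x => o x.1)) (a := a) (b := b) ?_ hv
      · rcases this with hv | ⟨hva, hbv⟩
        · exact h2 v hv
        · rcases Relation.reflTransGen_iff_eq_or_transGen.1 (hbv.trans hva) with hab | hba
          · exact h hab
          · exact h3 hba
      · rintro x y ⟨f, hf⟩
        by_cases hfe : f = e
        · subst hfe
          rw [ho] at hf
          exact .inr ⟨(congrArg Prod.fst hf).symm, (congrArg Prod.snd hf).symm⟩
        · exact .inl ⟨⟨f, hfe⟩, hf⟩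

theorem compatible_iff_delete {e : G.E} {a b : G.V} {κ : G.V → ℕ}
    {o : G.E → G.V × G.V} (ho : o e = (a, b)) :
    G.Compatible o κ ↔ (G.delete e).Compatible (fun x => o x.1) κ ∧ κ a ≤ κ b := by
  constructor
  · intro hc
    refine ⟨fun x => hc x.1, ?_⟩
    have := hc e
    rwa [ho] at this
  · rintro ⟨h1, h2⟩ x
    by_cases hx : x = e
    · subst hx
      rwa [ho]
    · exact h1 ⟨x, hx⟩

/-- Orientations in which the edge `e` points from `a` to `b`. -/
theorem card_compatOrientations_arc {e : G.E} {a b : G.V} (h : a ≠ b) (he : G.ends e = s(a, b))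
    (κ : G.V → ℕ) :
    ((G.compatOrientations κ).filter fun o => o e = (a, b)).card =
      (((G.delete e).compatOrientations κ).filter fun γ =>
        ¬ Relation.TransGen ((G.delete e).dirRel γ) b a ∧ κ a ≤ κ b).card := by
  refine card_bij (fun o _ => fun x => o x.1) ?_ ?_ ?_
  · intro o ho
    rw [mem_filter, mem_compatOrientations] at ho
    obtain ⟨⟨h1, h2⟩, ho⟩ := ho
    rw [G.acyclic_iff_delete h he ho] at h1
    rw [G.compatible_iff_delete ho] at h2
    rw [mem_filter, mem_compatOrientations]
    exact ⟨⟨h1.1, h2.1⟩, h1.2, h2.2⟩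
  · intro o ho o' ho' hoo
    funext x
    by_cases hx : x = e
    · subst hx
      rw [(mem_filter.1 ho).2, (mem_filter.1 ho').2]
    · exact congrFun hoo ⟨x, hx⟩
  · intro γ hγ
    rw [mem_filter, mem_compatOrientations] at hγ
    let o : G.E → G.V × G.V := fun x => if hx : x = e then (a, b) else γ ⟨x, hx⟩
    have ho : o e = (a, b) := by simp [o]
    have hr : (fun x : {x : G.E // x ≠ e} => o x.1) = γ := by
      funext x
      simp only [o, dif_neg x.2]
    refine ⟨o, ?_, hr⟩
    rw [mem_filter, mem_compatOrientations, G.acyclic_iff_delete h he ho,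
      G.compatible_iff_delete ho]
    rw [hr]
    exact ⟨⟨⟨hγ.1.1, hγ.2.1⟩, hγ.1.2, hγ.2.2⟩, ho⟩

theorem Compatible.le_of_transGen {G : WGraph} {o : G.E → G.V × G.V} {κ : G.V → ℕ}
    (hc : G.Compatible o κ) {u v : G.V} (h : Relation.TransGen (G.dirRel o) u v) :
    κ u ≤ κ v := by
  have hstep : ∀ x y, G.dirRel o x y → κ x ≤ κ y := by
    rintro x y ⟨f, hf⟩
    have := hc f
    rwa [hf] at this
  induction h with
  | single h => exact hstep _ _ h
  | tail _ h ih => exact ih.trans (hstep _ _ h)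

/-- Acyclic orientations of `G / e` are those of `G - e` with no walk between the endpoints
of `e`. -/
theorem card_compatOrientations_contract (e : G.E) {a b : G.V} (h : a ≠ b) {κ : G.V → ℕ}
    (hκ : κ a = κ b) :
    (((G.delete e).compatOrientations κ).filter fun γ =>
        ¬ Relation.TransGen ((G.delete e).dirRel γ) b a ∧
        ¬ Relation.TransGen ((G.delete e).dirRel γ) a b).card =
      ((contract e h).compatOrientations fun v : {v : G.V // v ≠ b} => κ v).card := by
  refine card_bij (fun γ _ => fun x => (proj h (γ x).1, proj h (γ x).2)) ?_ ?_ ?_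
  · intro γ hγ
    rw [mem_filter, mem_compatOrientations] at hγ
    obtain ⟨⟨⟨h1, h2⟩, h3⟩, h4, h5⟩ := hγ
    rw [mem_compatOrientations]
    refine ⟨⟨fun x => ?_, ?_⟩, fun x => ?_⟩
    · change _ = ((G.delete e).ends x).map (proj h)
      rw [← h1 x]
      rfl
    · refine map_irrefl_transGen (S := ({a, b} : Set G.V)) (eq_or_mem_of_proj_eq h) ?_ ?_ h2
      · rintro u (rfl | rfl) v (rfl | rfl)
        · exact h2 _
        · exact h5
        · exact h4
        · exact h2 _
      · rintro x y ⟨f, hf⟩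
        exact ⟨(γ f).1, (γ f).2, congrArg Prod.fst hf, congrArg Prod.snd hf, f, rfl⟩
    · exact (apply_proj h hκ _).trans_le ((h3 x).trans_eq (apply_proj h hκ _).symm)
  · intro γ hγ γ' hγ' hγγ
    rw [mem_filter, mem_compatOrientations] at hγ hγ'
    obtain ⟨⟨⟨h1, h2⟩, h3⟩, h4, h5⟩ := hγ
    funext x
    have hx : s((γ x).1, (γ x).2) = s((γ' x).1, (γ' x).2) := (h1 x).trans (hγ'.1.1.1 x).symm
    have hp := congrArg Prod.fst (congrFun hγγ x)
    dsimp only at hp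
    rcases Sym2.eq_iff.1 hx with ⟨hx1, hx2⟩ | ⟨hx1, hx2⟩
    · exact Prod.ext hx1 hx2
    · rw [← hx2] at hp
      have harc : Relation.TransGen ((G.delete e).dirRel γ) (γ x).1 (γ x).2 := .single ⟨x, rfl⟩
      exfalso
      rcases eq_or_mem_of_proj_eq h _ _ hp with heq | ⟨hu, hv⟩
      · rw [heq] at harc
        exact h2 _ harc
      · rcases hu with hu | hu <;> rcases hv with hv | hv <;> rw [hu, hv] at harc
        · exact h2 _ harc
        · exact h5 harc
        · exact h4 harc
        · exact h2 _ harc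
  · intro δ hδ
    rw [mem_compatOrientations] at hδ
    obtain ⟨⟨h1, h2⟩, h3⟩ := hδ
    have hlift : ∀ x : {x : G.E // x ≠ e}, ∃ p : G.V × G.V,
        s(p.1, p.2) = G.ends x.1 ∧ (proj h p.1, proj h p.2) = δ x := by
      intro x
      have hx : s((δ x).1, (δ x).2) = (G.ends x.1).map (proj h) := h1 x
      induction hs : G.ends x.1 with | _ u v
      rw [hs, Sym2.map_mk] at hx
      rcases Sym2.eq_iff.1 hx with ⟨hx1, hx2⟩ | ⟨hx1, hx2⟩
      · exact ⟨(u, v), rfl, Prod.ext hx1.symm hx2.symm⟩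
      · exact ⟨(v, u), Sym2.eq_swap, Prod.ext hx1.symm hx2.symm⟩
    choose γ hγ1 hγ2 using hlift
    have hstep : ∀ u v, Relation.TransGen ((G.delete e).dirRel γ) u v →
        Relation.TransGen ((contract e h).dirRel δ) (proj h u) (proj h v) := by
      intro u v huv
      refine Relation.TransGen.lift (proj h) ?_ _ _ huv
      rintro x y ⟨f, hf⟩
      refine ⟨f, ?_⟩
      rw [← hγ2 f]
      rw [hf]
    refine ⟨γ, ?_, funext hγ2⟩
    rw [mem_filter, mem_compatOrientations]
    refine ⟨⟨⟨hγ1, fun v hv => h2 _ (hstep _ _ hv)⟩, fun x => ?_⟩, fun hba => ?_, fun hab => ?_⟩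
    · have hx := h3 x
      rw [← hγ2 x] at hx
      exact (apply_proj h hκ _).symm.trans_le (hx.trans_eq (apply_proj h hκ _))
    · have := hstep _ _ hba
      rw [proj_left, proj_right] at this
      exact h2 _ this
    · have := hstep _ _ hab
      rw [proj_left, proj_right] at this
      exact h2 _ this

theorem card_compatOrientations_deletion_contraction {e : G.E} {a b : G.V} (h : a ≠ b)
    (he : G.ends e = s(a, b)) (κ : G.V → ℕ) :
    (G.compatOrientations κ).card = ((G.delete e).compatOrientations κ).card +
      if κ a = κ b then
        ((contract e h).compatOrientations fun v : {v : G.V // v ≠ b} => κ v).card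
      else 0 := by
  have hsplit : (G.compatOrientations κ).card =
      ((G.compatOrientations κ).filter fun o => o e = (a, b)).card +
      ((G.compatOrientations κ).filter fun o => o e = (b, a)).card := by
    rw [← card_filter_add_card_filter_not (s := G.compatOrientations κ) fun o => o e = (a, b)]
    congr 2
    refine filter_congr fun o ho => ?_
    have ho := (G.mem_compatOrientations.1 ho).1.1 e
    rw [he] at ho
    rcases Sym2.eq_iff.1 ho with ⟨h1, h2⟩ | ⟨h1, h2⟩
    · have : o e = (a, b) := Prod.ext h1 h2
      simp [this, h]
    · have : o e = (b, a) := Prod.ext h1 h2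
      simp [this, h.symm]
  rw [hsplit, G.card_compatOrientations_arc h he,
    G.card_compatOrientations_arc h.symm (he.trans Sym2.eq_swap), ← card_union_add_card_inter,
    ← filter_or, ← filter_and]
  congr 1
  · congr 1
    refine filter_true_of_mem fun γ hγ => ?_
    obtain ⟨hac, hc⟩ := (mem_compatOrientations _).1 hγ
    rcases lt_trichotomy (κ a) (κ b) with hlt | heq | hlt
    · exact .inl ⟨fun hba => absurd (hc.le_of_transGen hba) (not_le.2 hlt), hlt.le⟩
    · by_cases hba : Relation.TransGen ((G.delete e).dirRel γ) b a
      · exact .inr ⟨fun hab => hac.2 _ (hba.trans hab), heq.ge⟩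
      · exact .inl ⟨hba, heq.le⟩
    · exact .inr ⟨fun hab => absurd (hc.le_of_transGen hab) (not_le.2 hlt), hlt.le⟩
  · split_ifs with hκ
    · rw [← G.card_compatOrientations_contract e h hκ]
      simp [hκ]
    · rw [card_eq_zero, filter_eq_empty_iff]
      rintro γ _ ⟨⟨_, h1⟩, _, h2⟩
      exact hκ (le_antisymm h1 h2)

theorem ascSeries_deletion_contraction {e : G.E} {a b : G.V} (h : a ≠ b)
    (he : G.ends e = s(a, b)) :
    G.ascSeries = (G.delete e).ascSeries + (contract e h).ascSeries := by
  rw [ascSeries_eq_genSeries, ascSeries_eq_genSeries, ascSeries_eq_genSeries]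
  rw [genSeries_contract]
  change _ = G.genSeries _ + G.genSeries _
  rw [← genSeries_add]
  congr 1
  funext κ
  rw [G.card_compatOrientations_deletion_contraction h he κ]
  push_cast
  rfl

theorem X_eq_zero_of_loop {e : G.E} {a : G.V} (he : G.ends e = s(a, a)) : G.X ℚ = 0 := by
  rw [X_eq_genSeries]
  funext d
  refine sum_eq_zero fun κ _ => if_neg fun hp => hp e ?_
  simp [he]

theorem ascSeries_eq_zero_of_loop {e : G.E} {a : G.V} (he : G.ends e = s(a, a)) :
    G.ascSeries = 0 := by
  rw [ascSeries_eq_genSeries]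
  funext d
  refine sum_eq_zero fun κ _ => ?_
  rw [Nat.cast_eq_zero, card_eq_zero, eq_empty_iff_forall_notMem]
  intro o ho
  obtain ⟨⟨h1, h2⟩, _⟩ := G.mem_compatOrientations.1 ho
  have h3 := h1 e
  rw [he] at h3
  refine h2 a (.single ⟨e, ?_⟩)
  rcases Sym2.eq_iff.1 h3 with ⟨h4, h5⟩ | ⟨h4, h5⟩ <;> exact Prod.ext h4 h5

theorem genSeries_one_eq_pProd :
    G.genSeries (fun _ => 1) = pProd ((univ : Finset G.V).val.map G.w) := by
  ext d
  have hprod : pProd ((univ : Finset G.V).val.map G.w) = ∏ v : G.V, psum (G.w v) := by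
    rw [pProd, Multiset.map_map]; rfl
  have hcoeff : ∀ (n : ℕ) (m : ℕ →₀ ℕ),
      MvPowerSeries.coeff m (psum n) = if ∃ k, m = Finsupp.single k n then 1 else 0 :=
    fun _ _ => rfl
  rw [hprod, MvPowerSeries.coeff_prod]
  simp only [hcoeff, prod_boole, mem_univ, forall_const]
  change ∑ κ ∈ G.colorings d, (1 : ℚ) = _
  rw [← sum_filter]
  refine sum_bij (fun κ _ => Finsupp.equivFunOnFinite.symm
    fun v => Finsupp.single (κ v) (G.w v)) ?_ ?_ ?_ fun _ _ => rfl
  · intro κ hκ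
    rw [mem_filter, mem_finsuppAntidiag]
    exact ⟨⟨G.mem_colorings.1 hκ, subset_univ _⟩, fun v => ⟨κ v, rfl⟩⟩
  · intro κ _ κ' _ hκκ
    funext v
    exact (Finsupp.single_left_inj (G.wpos v).ne').1 (DFunLike.congr_fun hκκ v)
  · intro l hl
    rw [mem_filter, mem_finsuppAntidiag] at hl
    obtain ⟨⟨hd, _⟩, hl⟩ := hl
    choose κ hκ using hl
    refine ⟨κ, ?_, ?_⟩
    · rw [mem_colorings, ← hd]
      exact sum_congr rfl fun v _ => (hκ v).symm
    · ext1 v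
      exact (hκ v).symm

theorem X_of_isEmpty [IsEmpty G.E] : G.X ℚ = G.genSeries fun _ => 1 := by
  rw [X_eq_genSeries]
  congr 1
  funext κ
  exact if_pos fun e => isEmptyElim e

theorem ascSeries_of_isEmpty [IsEmpty G.E] : G.ascSeries = G.genSeries fun _ => 1 := by
  rw [ascSeries_eq_genSeries]
  congr 1
  funext κ
  have : G.compatOrientations κ = univ := by
    refine filter_true_of_mem fun o _ => ⟨⟨fun e => isEmptyElim e, fun v hv => ?_⟩,
      fun e => isEmptyElim e⟩
    obtain ⟨_, ⟨e, _⟩, _⟩ := Relation.TransGen.tail'_iff.1 hv |>.imp fun _ h => h.symm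
    exact isEmptyElim e
  simp [this]

end WGraph

/-- **(Crew–Spirkl)**: for any ℚ-linear map `Ω` acting as the involution `ω` on power
sums (`Ω p_λ = (-1)^{|λ|-ℓ(λ)} p_λ`),
`(-1)^{w(G)-|V(G)|} ω(X_{(G,w)}) = Σ_{(γ,κ)} Π_v x_{κ(v)}^{w(v)}`,
summing over acyclic orientations `γ` and colourings `κ` with `κ(u) ≤ κ(v)` for every
directed edge `u → v`. -/
theorem omega_chromatic_ascent_expansion
    (Ω : MvPowerSeries ℕ ℚ →ₗ[ℚ] MvPowerSeries ℕ ℚ)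
    (hΩ : ∀ M : Multiset ℕ, 0 ∉ M → Ω (pProd M) = (-1 : ℚ) ^ (M.sum - M.card) • pProd M)
    (G : WGraph) :
    ((-1 : ℚ) ^ (G.wG - Fintype.card G.V)) • Ω (G.X ℚ) = G.ascSeries := by
  induction hn : Fintype.card G.E generalizing G with
  | zero =>
    have : IsEmpty G.E := Fintype.card_eq_zero_iff.1 hn
    rw [G.X_of_isEmpty, G.ascSeries_of_isEmpty, G.genSeries_one_eq_pProd, hΩ]
    · have h1 : ((univ : Finset G.V).val.map G.w).sum = G.wG := rfl
      have h2 : ((univ : Finset G.V).val.map G.w).card = Fintype.card G.V := by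
        rw [Multiset.card_map]
        rfl
      rw [h1, h2, smul_smul, ← mul_pow]
      simp
    · intro h0
      obtain ⟨v, _, hv⟩ := Multiset.mem_map.1 h0
      exact (G.wpos v).ne' hv
  | succ n ih =>
    obtain ⟨e⟩ : Nonempty G.E := Fintype.card_pos_iff.1 (by omega)
    induction he : G.ends e with | _ a b
    by_cases h : a = b
    · subst h
      rw [G.X_eq_zero_of_loop he, G.ascSeries_eq_zero_of_loop he, map_zero, smul_zero]
    · have hE : Fintype.card {x : G.E // x ≠ e} = n := by
        simp [Fintype.card_subtype_compl, hn]
      have hdel := ih (G.delete e) (by convert hE)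
      have hcon := ih (WGraph.contract e h) (by convert hE)
      have hcard := G.card_contract e h
      have hle := G.card_le_wG
      rw [G.wG_contract e h, show G.wG - Fintype.card (WGraph.contract e h).V =
        G.wG - Fintype.card G.V + 1 by omega] at hcon
      rw [G.X_deletion_contraction h he, G.ascSeries_deletion_contraction h he, ← hdel, ← hcon,
        map_sub, smul_sub, pow_succ, mul_neg_one, neg_smul, sub_eq_add_neg]
      rfl
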